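/- Let (R, m, k) be a commutative noetherian local ring with m = I ⊕ J for nonzero ideals I, J, and let M be a finitely generated R-module with pd_R(M) ≤ 1. Then pd_{R/I}(M/IM) ≤ 1 and pd_{R/J}(M/JM) ≤ 1. -/

import Mathlib

universe u

/-- A minimal free resolution of the module `M` over `R`, where minimality is
measured with respect to the ideal `𝔪` (the maximal ideal in applications). -/
structure MinFreeRes (R : Type u) [CommRing R] (𝔪 : Ideal R)
    (M : Type u) [AddCommGroup M] [Module R M] : Type u where
  b : ℕ → ℕ
  aug : (Fin (b 0) → R) →ₗ[R] M
  d : ∀ n : ℕ, (Fin (b (n + 1)) → R) →ₗ[R] (Fin (b n) → R)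
  aug_surj : Function.Surjective aug
  exact_aug : LinearMap.range (d 0) = LinearMap.ker aug
  exact : ∀ n, LinearMap.range (d (n + 1)) = LinearMap.ker (d n)
  minimal : ∀ n, LinearMap.range (d n) ≤ 𝔪 • (⊤ : Submodule R (Fin (b n) → R))

namespace MinFreeRes

variable {R : Type u} [CommRing R] {𝔪 : Ideal R}
  {M : Type u} [AddCommGroup M] [Module R M]

/-- The `n`-th syzygy of `M` given by the minimal free resolution `F`:
`Syz 0 = M` and `Syz (n+1) = image of d n = ker of the previous map`. -/
def Syz (F : MinFreeRes R 𝔪 M) : ℕ → Type u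
  | 0 => M
  | n + 1 => ↥(LinearMap.range (F.d n))

instance (F : MinFreeRes R 𝔪 M) : ∀ n, AddCommGroup (F.Syz n)
  | 0 => inferInstanceAs (AddCommGroup M)
  | n + 1 => inferInstanceAs (AddCommGroup ↥(LinearMap.range (F.d n)))

instance (F : MinFreeRes R 𝔪 M) : ∀ n, Module R (F.Syz n)
  | 0 => inferInstanceAs (Module R M)
  | n + 1 => inferInstanceAs (Module R ↥(LinearMap.range (F.d n)))

/-- The Auslander transpose of `M` computed from the minimal free resolution `F`:
the cokernel of the `R`-dual of the first differential. -/
def Tr (F : MinFreeRes R 𝔪 M) : Type u :=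
  (Module.Dual R (Fin (F.b 1) → R)) ⧸ LinearMap.range ((F.d 0).dualMap)

instance (F : MinFreeRes R 𝔪 M) : AddCommGroup F.Tr :=
  inferInstanceAs (AddCommGroup
    ((Module.Dual R (Fin (F.b 1) → R)) ⧸ LinearMap.range ((F.d 0).dualMap)))

instance (F : MinFreeRes R 𝔪 M) : Module R F.Tr :=
  inferInstanceAs (Module R
    ((Module.Dual R (Fin (F.b 1) → R)) ⧸ LinearMap.range ((F.d 0).dualMap)))

/-- `Ext¹_R(M, N)` computed from the minimal free resolution `F` of `M`:
the homology of `Hom(F₀,N) → Hom(F₁,N) → Hom(F₂,N)` in the middle spot. -/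
def Ext1 (F : MinFreeRes R 𝔪 M) (N : Type u) [AddCommGroup N] [Module R N] : Type u :=
  ↥(LinearMap.ker (LinearMap.lcomp R N (F.d 1))) ⧸
    (LinearMap.range (LinearMap.lcomp R N (F.d 0))).comap
      (LinearMap.ker (LinearMap.lcomp R N (F.d 1))).subtype

instance (F : MinFreeRes R 𝔪 M) (N : Type u) [AddCommGroup N] [Module R N] :
    AddCommGroup (F.Ext1 N) :=
  inferInstanceAs (AddCommGroup
    (↥(LinearMap.ker (LinearMap.lcomp R N (F.d 1))) ⧸
      (LinearMap.range (LinearMap.lcomp R N (F.d 0))).comap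
        (LinearMap.ker (LinearMap.lcomp R N (F.d 1))).subtype))

instance (F : MinFreeRes R 𝔪 M) (N : Type u) [AddCommGroup N] [Module R N] :
    Module R (F.Ext1 N) :=
  inferInstanceAs (Module R
    (↥(LinearMap.ker (LinearMap.lcomp R N (F.d 1))) ⧸
      (LinearMap.range (LinearMap.lcomp R N (F.d 0))).comap
        (LinearMap.ker (LinearMap.lcomp R N (F.d 1))).subtype))

end MinFreeRes

/-- `S` is (isomorphic to) a direct summand of `M` as an `R`-module. -/
def IsDirectSummand (R : Type u) [CommRing R] (S M : Type u)
    [AddCommGroup S] [Module R S] [AddCommGroup M] [Module R M] : Prop :=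
  ∃ (i : S →ₗ[R] M) (p : M →ₗ[R] S), p ∘ₗ i = LinearMap.id

/-- `S` belongs to `add X`: it is a direct summand of a finite direct sum of copies of `X`. -/
def InAddClosure (R : Type u) [CommRing R] (S X : Type u)
    [AddCommGroup S] [Module R S] [AddCommGroup X] [Module R X] : Prop :=
  ∃ r : ℕ, IsDirectSummand R S (Fin r → X)

/-- There exists a short exact sequence `0 → A → B → C → 0` of `R`-modules. -/
def ExistsSES (R : Type u) [CommRing R] (A B C : Type u)
    [AddCommGroup A] [Module R A] [AddCommGroup B] [Module R B]
    [AddCommGroup C] [Module R C] : Prop :=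
  ∃ (i : A →ₗ[R] B) (p : B →ₗ[R] C),
    Function.Injective i ∧ Function.Surjective p ∧ LinearMap.range i = LinearMap.ker p

/-- The `R`-module `M` has depth (with respect to the ideal `𝔪`) equal to `t`:
there is an `M`-regular sequence of length `t` in `𝔪` and no longer one. -/
def HasDepth (R : Type u) [CommRing R] (𝔪 : Ideal R) (M : Type u)
    [AddCommGroup M] [Module R M] (t : ℕ) : Prop :=
  (∃ rs : List R, rs.length = t ∧ (∀ x ∈ rs, x ∈ 𝔪) ∧ RingTheory.Sequence.IsRegular M rs) ∧
  ∀ rs : List R, (∀ x ∈ rs, x ∈ 𝔪) → RingTheory.Sequence.IsRegular M rs → rs.length ≤ t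

/-- `𝔪` needs at least (and exactly) `e` generators. -/
def HasMinGens (R : Type u) [CommRing R] (𝔪 : Ideal R) (e : ℕ) : Prop :=
  (∃ s : Finset R, s.card = e ∧ Ideal.span (s : Set R) = 𝔪) ∧
  ∀ s : Finset R, Ideal.span (s : Set R) = 𝔪 → e ≤ s.card

/-- `R` is a regular local ring with maximal ideal `𝔪`: `𝔪` is generated by
`dim R` elements. -/
def IsRegularWrt (R : Type u) [CommRing R] (𝔪 : Ideal R) : Prop :=
  ∃ s : Finset R, Ideal.span (s : Set R) = 𝔪 ∧ (s.card : WithBot ℕ∞) = ringKrullDim R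

/-- The local ring `(R, 𝔪)` of dimension `d` has Hilbert–Samuel multiplicity `e`:
the function `n ↦ length (R / 𝔪^(n+1))` eventually agrees with a polynomial of
degree `d` whose leading coefficient is `e / d!`. -/
def HasHSMultiplicity (R : Type u) [CommRing R] (𝔪 : Ideal R) (d e : ℕ) : Prop :=
  ∃ p : Polynomial ℚ, p.natDegree = d ∧ p.leadingCoeff * (d.factorial : ℚ) = e ∧
    ∀ᶠ n : ℕ in Filter.atTop, ∃ l : ℕ,
      Order.krullDim (Submodule R (R ⧸ 𝔪 ^ (n + 1))) = l ∧ (l : ℚ) = p.eval (n : ℚ)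

open CategoryTheory in
/-- If `p : P → N` and `q : Q → N` are surjections from projective modules, then projectivity of
`ker p` implies that of `ker q`. -/
theorem projective_ker_of_projective_ker {S : Type u} [CommRing S]
    {P Q N : Type u} [AddCommGroup P] [Module S P] [AddCommGroup Q] [Module S Q]
    [AddCommGroup N] [Module S N] [Module.Projective S P] [Module.Projective S Q]
    (p : P →ₗ[S] N) (q : Q →ₗ[S] N) (hp : Function.Surjective p) (hq : Function.Surjective q)
    (h : Module.Projective S (LinearMap.ker p)) : Module.Projective S (LinearMap.ker q) := by
  have key {P : Type u} [AddCommGroup P] [Module S P] [Module.Projective S P] (p : P →ₗ[S] N)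
      (hp : Function.Surjective p) : HasProjectiveDimensionLT (ModuleCat.of S N) 2 ↔
        Module.Projective S (LinearMap.ker p) := by
    have hP : Projective p.shortComplexKer.X₂ :=
      (IsProjective.iff_projective P).1 inferInstance
    have := (LinearMap.shortExact_shortComplexKer hp).hasProjectiveDimensionLT_X₃_iff 0 hP
    rw [zero_add, ← projective_iff_hasProjectiveDimensionLT_one] at this
    exact this.trans (IsProjective.iff_projective _).symm
  exact (key q hq).1 ((key p hp).2 h)

/-- If the range of `f` is projective and its kernel is finitely generated and contained in `𝔞 • ⊤`
with `𝔞` in the Jacobson radical, then `f` is injective. -/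
theorem ker_eq_bot_of_projective_range {S : Type*} [CommRing S] {𝔞 : Ideal S}
    (h𝔞 : 𝔞 ≤ (⊥ : Ideal S).jacobson) {P Q : Type*} [AddCommGroup P] [Module S P]
    [AddCommGroup Q] [Module S Q] (f : P →ₗ[S] Q) [Module.Projective S (LinearMap.range f)]
    (hfg : (LinearMap.ker f).FG) (hle : LinearMap.ker f ≤ 𝔞 • ⊤) : LinearMap.ker f = ⊥ := by
  obtain ⟨s, hs⟩ := f.rangeRestrict.exists_rightInverse_of_surjective f.range_rangeRestrict
  have hs' (y) : f (s y) = y := congrArg Subtype.val (LinearMap.congr_fun hs y)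
  let r : P →ₗ[S] P := LinearMap.id - s ∘ₗ f.rangeRestrict
  have hr : LinearMap.range r ≤ LinearMap.ker f := by
    rintro _ ⟨x, rfl⟩
    simp [r, hs']
  refine Submodule.eq_bot_of_le_smul_of_le_jacobson_bot 𝔞 _ hfg (fun x hx ↦ ?_) h𝔞
  have hrx : r x = x := by
    have : f.rangeRestrict x = 0 := Subtype.ext hx
    simp [r, this]
  have hmem : r x ∈ (𝔞 • ⊤ : Submodule S P).map r := Submodule.mem_map_of_mem (hle hx)
  rw [hrx, Submodule.map_smul'', Submodule.map_top] at hmem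
  exact Submodule.smul_mono le_rfl hr hmem

theorem Ideal.mem_smul_top_pi_iff {R ι : Type*} [CommRing R] [Fintype ι] (I : Ideal R)
    (x : ι → R) : x ∈ (I • ⊤ : Submodule R (ι → R)) ↔ ∀ i, x i ∈ I := by
  classical
  refine ⟨fun h i ↦ ?_, fun h ↦ ?_⟩
  · simpa using Submodule.smul_top_le_comap_smul_top I (LinearMap.proj (φ := fun _ : ι ↦ R) i) h
  · rw [← Finset.univ_sum_single x]
    refine Submodule.sum_mem _ fun i _ ↦ ?_
    have : Pi.single i (x i) = x i • (Pi.single i 1 : ι → R) := by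
      rw [← Pi.single_smul', smul_eq_mul, mul_one]
    rw [this]
    exact Submodule.smul_mem_smul (h i) trivial

theorem Fintype.linearCombination_single_quotient {R ι N : Type*} [CommRing R] [Fintype ι]
    [DecidableEq ι] (I : Ideal R) [AddCommGroup N] [Module R N] [Module (R ⧸ I) N]
    [IsScalarTower R (R ⧸ I) N] (g : (ι → R) →ₗ[R] N) (x : ι → R) :
    Fintype.linearCombination (R ⧸ I) (fun i ↦ g (Pi.single i 1))
      (fun i ↦ Ideal.Quotient.mk I (x i)) = g x := by
  conv_rhs => rw [LinearMap.pi_apply_eq_sum_univ g x]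
  rw [Fintype.linearCombination_apply]
  refine Finset.sum_congr rfl fun i _ ↦ ?_
  rw [← Ideal.Quotient.algebraMap_eq, algebraMap_smul]
  congr 2
  ext j
  simp [Pi.single_apply, eq_comm]

section DecomposableMaximalIdeal

variable {R : Type u} [CommRing R] [IsLocalRing R] {I J : Ideal R}

/-- An injective matrix with entries in the maximal ideal `I ⊕ J` stays injective modulo `I`. -/
theorem mem_smul_top_of_apply_mem_smul_top (hJ : J ≠ ⊥) (hdisj : I ⊓ J = ⊥)
    (hsum : I ⊔ J = IsLocalRing.maximalIdeal R) {ι κ : Type*} [Fintype ι] [Fintype κ]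
    (f : (ι → R) →ₗ[R] (κ → R)) (hf : Function.Injective f)
    (hmin : LinearMap.range f ≤ IsLocalRing.maximalIdeal R • ⊤) {x : ι → R}
    (hx : f x ∈ (I • ⊤ : Submodule R (κ → R))) : x ∈ (I • ⊤ : Submodule R (ι → R)) := by
  classical
  rw [Ideal.mem_smul_top_pi_iff] at hx ⊢
  have hIJ {a b : R} (ha : a ∈ I) (hb : b ∈ J) : a * b = 0 := by
    have : a * b ∈ I ⊓ J := ⟨I.mul_mem_right b ha, J.mul_mem_left a hb⟩
    rwa [hdisj] at this
  have hJx {b : R} (hb : b ∈ J) (i : ι) : b * x i = 0 := by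
    have : b • x = 0 := hf <| by
      rw [map_smul, map_zero]
      ext k
      simpa [mul_comm] using hIJ (hx k) hb
    exact congrFun this i
  have hxm (i : ι) : x i ∈ I ⊔ J := by
    rw [hsum, IsLocalRing.mem_maximalIdeal]
    intro hu
    exact hJ ((Submodule.eq_bot_iff _).2 fun b hb ↦ (hu.mul_left_eq_zero).1 (hJx hb i))
  choose u hu v hv huv using fun i ↦ Submodule.mem_sup.1 (hxm i)
  have hmv {c : R} (hc : c ∈ IsLocalRing.maximalIdeal R) (i : ι) : c * v i = 0 := by
    rw [← hsum] at hc
    obtain ⟨a, ha, b, hb, rfl⟩ := Submodule.mem_sup.1 hc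
    have h := hJx hb i
    rw [← huv i, mul_add, mul_comm b (u i), hIJ (hu i) hb, zero_add] at h
    rw [add_mul, hIJ ha (hv i), h, add_zero]
  have hv0 : v = 0 := hf <| by
    rw [LinearMap.pi_apply_eq_sum_univ f v, map_zero]
    refine Finset.sum_eq_zero fun i _ ↦ funext fun k ↦ ?_
    have := (Ideal.mem_smul_top_pi_iff _ _).1
      (hmin (LinearMap.mem_range_self f fun j ↦ if i = j then 1 else 0)) k
    simpa [mul_comm] using hmv this i
  intro i
  rw [← huv i, hv0]
  simpa using hu i

theorem exists_surjective_projective_ker_quotient (hJ : J ≠ ⊥) (hdisj : I ⊓ J = ⊥)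
    (hsum : I ⊔ J = IsLocalRing.maximalIdeal R) {M : Type u} [AddCommGroup M] [Module R M]
    {ι κ : Type*} [Fintype ι] [Fintype κ]
    (f : (ι → R) →ₗ[R] (κ → R)) (hf : Function.Injective f)
    (hmin : LinearMap.range f ≤ IsLocalRing.maximalIdeal R • ⊤)
    (g : (κ → R) →ₗ[R] M) (hg : Function.Surjective g)
    (hfg : LinearMap.range f = LinearMap.ker g) :
    ∃ p : (κ → R ⧸ I) →ₗ[R ⧸ I] (M ⧸ (I • ⊤ : Submodule R M)),
      Function.Surjective p ∧ Module.Projective (R ⧸ I) (LinearMap.ker p) := by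
  classical
  let π : (κ → R) →ₗ[R] (κ → R ⧸ I) := (Algebra.linearMap R (R ⧸ I)).compLeft κ
  have hπ (x : κ → R) : π x = 0 ↔ x ∈ (I • ⊤ : Submodule R (κ → R)) := by
    rw [Ideal.mem_smul_top_pi_iff]
    simp [π, funext_iff, Ideal.Quotient.eq_zero_iff_mem]
  let g' := (I • ⊤ : Submodule R M).mkQ ∘ₗ g
  let p := Fintype.linearCombination (R ⧸ I) (fun i ↦ g' (Pi.single i 1))
  let q := Fintype.linearCombination (R ⧸ I) (fun i ↦ (π ∘ₗ f) (Pi.single i 1))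
  have hp (x : κ → R) : p (Ideal.Quotient.mk I ∘ x) = g' x :=
    Fintype.linearCombination_single_quotient I g' x
  have hq (x : ι → R) : q (Ideal.Quotient.mk I ∘ x) = π (f x) :=
    Fintype.linearCombination_single_quotient I (π ∘ₗ f) x
  have hqinj : Function.Injective q := by
    rw [injective_iff_map_eq_zero]
    intro y hy
    obtain ⟨x, rfl⟩ := Ideal.Quotient.mk_surjective.comp_left y
    rw [hq, hπ] at hy
    have := mem_smul_top_of_apply_mem_smul_top hJ hdisj hsum f hf hmin hy
    rw [Ideal.mem_smul_top_pi_iff] at this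
    exact funext fun i ↦ Ideal.Quotient.eq_zero_iff_mem.2 (this i)
  have hrange : LinearMap.range q = LinearMap.ker p := by
    ext y
    refine ⟨?_, fun hy ↦ ?_⟩
    · rintro ⟨z, rfl⟩
      obtain ⟨x, rfl⟩ := Ideal.Quotient.mk_surjective.comp_left z
      have : g (f x) = 0 := (hfg.le (LinearMap.mem_range_self f x) :)
      rw [LinearMap.mem_ker, hq]
      exact (hp (f x)).trans (by simp [g', this])
    · obtain ⟨x, rfl⟩ := Ideal.Quotient.mk_surjective.comp_left y
      rw [LinearMap.mem_ker, hp] at hy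
      have hgx : g x ∈ (I • ⊤ : Submodule R M) := by simpa [g'] using hy
      rw [← LinearMap.range_eq_top.2 hg, ← Submodule.map_top, ← Submodule.map_smul''] at hgx
      obtain ⟨z, hz, hzx⟩ := hgx
      have : x - z ∈ LinearMap.ker g := by simp [hzx]
      rw [← hfg] at this
      obtain ⟨w, hw⟩ := this
      refine ⟨Ideal.Quotient.mk I ∘ w, ?_⟩
      rw [hq, hw, map_sub, (hπ z).2 hz, sub_zero]
      rfl
  refine ⟨p, fun y ↦ ?_, ?_⟩
  · obtain ⟨x, rfl⟩ := (Submodule.mkQ_surjective _).comp hg y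
    exact ⟨_, hp x⟩
  · rw [← hrange]
    exact Module.Projective.of_equiv (LinearEquiv.ofInjective q hqinj)

theorem subsingleton_syz_two_quotient [IsNoetherianRing R] (hJ : J ≠ ⊥) (hdisj : I ⊓ J = ⊥)
    (hsum : I ⊔ J = IsLocalRing.maximalIdeal R) {M : Type u} [AddCommGroup M] [Module R M]
    (F : MinFreeRes R (IsLocalRing.maximalIdeal R) M) (hF : Subsingleton (F.Syz 2))
    (G : MinFreeRes (R ⧸ I) ((IsLocalRing.maximalIdeal R).map (Ideal.Quotient.mk I))
      (M ⧸ (I • ⊤ : Submodule R M))) : Subsingleton (G.Syz 2) := by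
  have hF0 : Function.Injective (F.d 0) := by
    rw [← LinearMap.ker_eq_bot, ← F.exact 0]
    exact Submodule.subsingleton_iff_eq_bot.1 hF
  obtain ⟨p, hp, hker⟩ := exists_surjective_projective_ker_quotient hJ hdisj hsum (F.d 0) hF0
    (F.minimal 0) F.aug F.aug_surj F.exact_aug
  have hrange : Module.Projective (R ⧸ I) (LinearMap.range (G.d 0)) := by
    rw [G.exact_aug]
    exact projective_ker_of_projective_ker p G.aug hp G.aug_surj hker
  have hjac : (IsLocalRing.maximalIdeal R).map (Ideal.Quotient.mk I) ≤
      (⊥ : Ideal (R ⧸ I)).jacobson := by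
    refine Ideal.map_le_iff_le_comap.2 fun x hx ↦ Ideal.mem_jacobson_bot.2 fun y ↦ ?_
    obtain ⟨y, rfl⟩ := Ideal.Quotient.mk_surjective y
    rw [← IsLocalRing.jacobson_eq_maximalIdeal ⊥ bot_ne_top] at hx
    simpa using (Ideal.mem_jacobson_bot.1 hx y).map (Ideal.Quotient.mk I)
  refine Submodule.subsingleton_iff_eq_bot.2 ?_
  rw [G.exact 0]
  exact ker_eq_bot_of_projective_range hjac (G.d 0) (IsNoetherian.noetherian _)
    ((G.exact 0).ge.trans (G.minimal 1))

end DecomposableMaximalIdeal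

/-- if `𝔪 = I ⊕ J` with `I, J` nonzero ideals and `pd_R M ≤ 1`, then
`pd_{R/I}(M/IM) ≤ 1` and `pd_{R/J}(M/JM) ≤ 1`. -/
theorem stmt19 (R : Type u) [CommRing R] [IsNoetherianRing R] [IsLocalRing R]
    (I J : Ideal R) (hI : I ≠ ⊥) (hJ : J ≠ ⊥)
    (hdisj : I ⊓ J = ⊥) (hsum : I ⊔ J = IsLocalRing.maximalIdeal R)
    (M : Type u) [AddCommGroup M] [Module R M] [Module.Finite R M]
    (hpd : ∃ F : MinFreeRes R (IsLocalRing.maximalIdeal R) M, Subsingleton (F.Syz 2)) :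
    (∀ G : MinFreeRes (R ⧸ I) ((IsLocalRing.maximalIdeal R).map (Ideal.Quotient.mk I))
        (M ⧸ (I • ⊤ : Submodule R M)), Subsingleton (G.Syz 2)) ∧
    (∀ G : MinFreeRes (R ⧸ J) ((IsLocalRing.maximalIdeal R).map (Ideal.Quotient.mk J))
        (M ⧸ (J • ⊤ : Submodule R M)), Subsingleton (G.Syz 2)) := by
  obtain ⟨F, hF⟩ := hpd
  exact ⟨subsingleton_syz_two_quotient hJ hdisj hsum F hF,
    subsingleton_syz_two_quotient hI (inf_comm I J ▸ hdisj) (sup_comm I J ▸ hsum) F hF⟩
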